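/- arXiv:1505.08044 — 2 statements merged into one kernel-verified Lean document; each statement's English description precedes it below -/
import Mathlib

section
/- Let p ∈ (0,1) and let H be a finite hypergraph with rank r(H) = k. Let X ⊆ V(H) be an independent set in H, and suppose Y_1, Y_2, ..., Y_m are pairwise disjoint nonempty sets of vertices, each disjoint from X, such that X ∪ Y_i ∈ H for every i ≤ m. Then r(H ∪ {X}) = k, and id_p(H ∪ {X}) < id_p(H) ≤ id_p(H ∪ {X}) + p^{|X|}(1 - p^{k-|X|})^m. -/
open Filter Topology

/-- A finite hypergraph with vertices in `ℕ`: a finite vertex set together with a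
finite collection of hyperedges (finite sets of vertices). -/
structure FinHG where
  verts : Finset ℕ
  edges : Finset (Finset ℕ)

namespace FinHG

/-- A finite hypergraph is valid if every hyperedge is a nonempty subset of the vertex set. -/
def Valid (H : FinHG) : Prop :=
  ∀ e ∈ H.edges, e.Nonempty ∧ e ⊆ H.verts

/-- `I` is an independent set of `H`: it contains no hyperedge. -/
def Indep (H : FinHG) (I : Finset ℕ) : Prop :=
  ∀ e ∈ H.edges, ¬ e ⊆ I

/-- The independence `p`-density of a finite hypergraph:
`∑_{I independent} p^|I| (1-p)^(|V| - |I|)`. -/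
noncomputable def idp (H : FinHG) (p : ℝ) : ℝ :=
  ∑ I ∈ H.verts.powerset.filter fun I => ∀ e ∈ H.edges, ¬ e ⊆ I,
    p ^ I.card * (1 - p) ^ (H.verts.card - I.card)

/-- The rank of a finite hypergraph: the supremum of the sizes of its hyperedges. -/
def rank (H : FinHG) : ℕ := H.edges.sup Finset.card

/-- The induced subhypergraph on a set `W` of vertices. -/
def induced (H : FinHG) (W : Finset ℕ) : FinHG :=
  ⟨W, H.edges.filter fun e => e ⊆ W⟩

end FinHG

/-- A countable hypergraph: the vertex set is a subset of `ℕ` and the hyperedges are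
finite sets of vertices. -/
structure HG where
  verts : Set ℕ
  edges : Set (Finset ℕ)

namespace HG

/-- A countable hypergraph is valid if every hyperedge is a nonempty subset of the
vertex set. -/
def Valid (H : HG) : Prop :=
  ∀ e ∈ H.edges, e.Nonempty ∧ ↑e ⊆ H.verts

/-- The rank of `H` is at most `k`: every hyperedge has size at most `k`. -/
def RankLe (H : HG) (k : ℕ) : Prop := ∀ e ∈ H.edges, e.card ≤ k

/-- The rank of `H` (the supremum of the sizes of hyperedges) equals `k`. -/
def RankEq (H : HG) (k : ℕ) : Prop := H.RankLe k ∧ ∃ e ∈ H.edges, e.card = k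

/-- A chain for a countable hypergraph `H`: an increasing sequence of finite
hypergraphs, each an induced subhypergraph of the next, whose vertex sets and
hyperedge sets union to those of `H`. -/
def IsChain (H : HG) (C : ℕ → FinHG) : Prop :=
  (∀ n, ∀ e ∈ (C n).edges, e ⊆ (C n).verts) ∧
  (∀ n, (C n).verts ⊆ (C (n + 1)).verts) ∧
  (∀ n, (C n).edges = (C (n + 1)).edges.filter fun e => e ⊆ (C n).verts) ∧
  (⋃ n, ((C n).verts : Set ℕ)) = H.verts ∧
  (⋃ n, ((C n).edges : Set (Finset ℕ))) = H.edges

/-- `x` is the independence `p`-density of the countable hypergraph `H`: along every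
chain for `H`, the independence `p`-densities converge to `x`. -/
def idpLim (H : HG) (p x : ℝ) : Prop :=
  ∀ C : ℕ → FinHG, H.IsChain C → Tendsto (fun n => (C n).idp p) atTop (𝓝 x)

/-- The neighbourhood hypergraph of a set `A` of vertices:
`N_H(A) = {F ⊆ V(H) \ A : F ∪ A ∈ H}`. -/
def nbhd (H : HG) (A : Finset ℕ) : Set (Finset ℕ) :=
  {F | ↑F ⊆ H.verts \ ↑A ∧ F ∪ A ∈ H.edges}

end HG

/-- `H_{k,p}`: the set of independence `p`-densities of countable hypergraphs of rank
at most `k`. -/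
def HkSet (k : ℕ) (p : ℝ) : Set ℝ :=
  {x | ∃ H : HG, H.Valid ∧ H.RankLe k ∧ H.idpLim p x}

/-- A collection `E` of finite sets contains a matching (pairwise disjoint nonempty
members) of size at least `m`. -/
def HasMatching (E : Set (Finset ℕ)) (m : ℕ) : Prop :=
  ∃ M : Finset (Finset ℕ), ↑M ⊆ E ∧ (∀ e ∈ M, e.Nonempty) ∧
    (M : Set (Finset ℕ)).Pairwise Disjoint ∧ m ≤ M.card

/-- A collection `E` of finite sets contains an infinite matching: an infinite
collection of pairwise disjoint nonempty members. -/
def HasInfMatching (E : Set (Finset ℕ)) : Prop :=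
  ∃ Y : ℕ → Finset ℕ, (∀ i, Y i ∈ E) ∧ (∀ i, (Y i).Nonempty) ∧
    ∀ i j, i ≠ j → Disjoint (Y i) (Y j)

/-- The probability that a `p`-random subset of `V` contains `X` is `p ^ #X`. -/
theorem sum_weight_superset (p : ℝ) {X V : Finset ℕ} (hX : X ⊆ V) :
    ∑ I ∈ V.powerset with X ⊆ I, p ^ I.card * (1 - p) ^ (V.card - I.card) = p ^ X.card := by
  have hset : V.powerset.filter (fun I => X ⊆ I) = (V \ X).powerset.image (X ∪ ·) := by
    rw [← Finset.Icc_eq_image_powerset hX]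
    ext I
    simp [and_comm]
  rw [hset, Finset.sum_image]
  · have h := Finset.sum_pow_mul_eq_add_pow p (1 - p) (V \ X)
    rw [add_sub_cancel, one_pow] at h
    conv_rhs => rw [← mul_one (p ^ X.card), ← h, Finset.mul_sum]
    refine Finset.sum_congr rfl fun J hJ => ?_
    have hd : Disjoint X J :=
      Finset.disjoint_sdiff.mono_right (Finset.mem_powerset.1 hJ)
    rw [Finset.card_union_of_disjoint hd, Finset.card_sdiff_of_subset hX, pow_add, Nat.sub_sub,
      mul_assoc]
  · intro J hJ K hK hJK
    have hJ' : Disjoint X J :=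
      Finset.disjoint_sdiff.mono_right (Finset.mem_powerset.1 hJ)
    have hK' : Disjoint X K :=
      Finset.disjoint_sdiff.mono_right (Finset.mem_powerset.1 hK)
    rw [← Finset.union_sdiff_cancel_left hJ', ← Finset.union_sdiff_cancel_left hK']
    exact congrArg (· \ X) hJK

/-- The probability that a `p`-random subset of `V` contains `X` but none of the sets `Y i`,
which are pairwise disjoint and disjoint from `X`. -/
theorem sum_weight_superset_avoiding {ι : Type*} (p : ℝ) {V : Finset ℕ} (Y : ι → Finset ℕ)
    (hYdisj : ∀ i j, i ≠ j → Disjoint (Y i) (Y j)) (hYV : ∀ i, Y i ⊆ V)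
    (s : Finset ι) (X : Finset ℕ) (hX : X ⊆ V) (hYX : ∀ i ∈ s, Disjoint (Y i) X) :
    ∑ I ∈ V.powerset with X ⊆ I ∧ ∀ i ∈ s, ¬ Y i ⊆ I,
        p ^ I.card * (1 - p) ^ (V.card - I.card) =
      p ^ X.card * ∏ i ∈ s, (1 - p ^ (Y i).card) := by
  classical
  induction s using Finset.induction_on generalizing X with
  | empty => simpa using sum_weight_superset p hX
  | insert a s ha ih =>
    have hsX : ∀ i ∈ s, Disjoint (Y i) X := fun i hi => hYX i (Finset.mem_insert_of_mem hi)
    have haX : Disjoint X (Y a) := (hYX a (Finset.mem_insert_self a s)).symm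
    have h₁ := ih X hX hsX
    have h₂ := ih (X ∪ Y a) (Finset.union_subset hX (hYV a)) fun i hi =>
      Finset.disjoint_union_right.2 ⟨hsX i hi, hYdisj i a fun h => ha (h ▸ hi)⟩
    rw [← Finset.sum_filter_add_sum_filter_not _ (fun I => Y a ⊆ I), Finset.filter_filter,
      Finset.filter_filter] at h₁
    have e₁ : V.powerset.filter (fun I => (X ⊆ I ∧ ∀ i ∈ s, ¬ Y i ⊆ I) ∧ Y a ⊆ I) =
        V.powerset.filter (fun I => X ∪ Y a ⊆ I ∧ ∀ i ∈ s, ¬ Y i ⊆ I) :=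
      Finset.filter_congr fun I _ => by rw [Finset.union_subset_iff]; tauto
    have e₂ : V.powerset.filter (fun I => (X ⊆ I ∧ ∀ i ∈ s, ¬ Y i ⊆ I) ∧ ¬ Y a ⊆ I) =
        V.powerset.filter (fun I => X ⊆ I ∧ ∀ i ∈ insert a s, ¬ Y i ⊆ I) :=
      Finset.filter_congr fun I _ => by rw [Finset.forall_mem_insert]; tauto
    rw [e₁, e₂, h₂, Finset.card_union_of_disjoint haX, pow_add] at h₁
    rw [Finset.prod_insert ha]
    linear_combination h₁

/-- Adding the hyperedge `X` lowers the independence density by the weight of the independent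
sets containing `X`. -/
theorem FinHG.idp_eq_idp_insert_add (H : FinHG) (p : ℝ) (X : Finset ℕ) :
    H.idp p = (FinHG.mk H.verts (insert X H.edges)).idp p +
      ∑ I ∈ H.verts.powerset with (∀ e ∈ H.edges, ¬ e ⊆ I) ∧ X ⊆ I,
        p ^ I.card * (1 - p) ^ (H.verts.card - I.card) := by
  unfold FinHG.idp
  rw [← Finset.sum_filter_not_add_sum_filter _ (fun I => X ⊆ I), Finset.filter_filter,
    Finset.filter_filter]
  congr 2
  exact Finset.filter_congr fun I _ => by rw [Finset.forall_mem_insert]; tauto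

/-- Adding an independent set `X` as a hyperedge, when `X ∪ Y_i ∈ H` for pairwise
disjoint nonempty sets `Y_1, …, Y_m` disjoint from `X`: the rank is unchanged and
`id_p(H ∪ {X}) < id_p(H) ≤ id_p(H ∪ {X}) + p^{|X|} (1 - p^{k-|X|})^m`. -/
theorem stmt_10 (p : ℝ) (hp0 : 0 < p) (hp1 : p < 1) (k : ℕ)
    (H : FinHG) (hHval : H.Valid) (hrank : H.rank = k)
    (X : Finset ℕ) (hXsub : X ⊆ H.verts) (hXne : X.Nonempty) (hXind : H.Indep X)
    (m : ℕ) (hm : 1 ≤ m) (Y : Fin m → Finset ℕ)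
    (hYne : ∀ i, (Y i).Nonempty)
    (hYdisj : ∀ i j, i ≠ j → Disjoint (Y i) (Y j))
    (hYX : ∀ i, Disjoint (Y i) X)
    (hYe : ∀ i, X ∪ Y i ∈ H.edges) :
    (FinHG.mk H.verts (insert X H.edges)).rank = k ∧
      (FinHG.mk H.verts (insert X H.edges)).idp p < H.idp p ∧
      H.idp p ≤ (FinHG.mk H.verts (insert X H.edges)).idp p +
        p ^ X.card * (1 - p ^ (k - X.card)) ^ m := by
  have hweight : ∀ I : Finset ℕ, 0 < p ^ I.card * (1 - p) ^ (H.verts.card - I.card) := fun I =>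
    mul_pos (pow_pos hp0 _) (pow_pos (sub_pos.2 hp1) _)
  have hcard : ∀ i, X.card + (Y i).card ≤ k := fun i => by
    rw [← Finset.card_union_of_disjoint (hYX i).symm, ← hrank]
    exact Finset.le_sup (f := Finset.card) (hYe i)
  have hYV : ∀ i, Y i ⊆ H.verts := fun i =>
    Finset.subset_union_right.trans (hHval _ (hYe i)).2
  refine ⟨?_, ?_, ?_⟩
  · have hXk : X.card ≤ k := (Nat.le_add_right _ _).trans (hcard ⟨0, hm⟩)
    rw [FinHG.rank] at hrank ⊢
    rw [Finset.sup_insert, hrank]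
    exact sup_eq_right.2 hXk
  · rw [H.idp_eq_idp_insert_add p X]
    refine lt_add_of_pos_right _ (Finset.sum_pos (fun I _ => hweight I) ⟨X, ?_⟩)
    exact Finset.mem_filter.2 ⟨Finset.mem_powerset.2 hXsub, hXind, subset_rfl⟩
  · rw [H.idp_eq_idp_insert_add p X]
    refine add_le_add_right ?_ _
    calc
      _ ≤ p ^ X.card * ∏ i, (1 - p ^ (Y i).card) := by
        rw [← sum_weight_superset_avoiding p Y hYdisj hYV _ X hXsub fun i _ => hYX i]
        refine Finset.sum_le_sum_of_subset_of_nonneg (fun I hI => ?_) fun I _ _ => (hweight I).le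
        simp only [Finset.mem_filter] at hI ⊢
        obtain ⟨hIV, hIind, hXI⟩ := hI
        exact ⟨hIV, hXI, fun i _ hi => hIind _ (hYe i) (Finset.union_subset hXI hi)⟩
      _ ≤ p ^ X.card * ∏ _i : Fin m, (1 - p ^ (k - X.card)) := by
        refine mul_le_mul_of_nonneg_left (Finset.prod_le_prod ?_ ?_) (pow_nonneg hp0.le _)
        · exact fun i _ => sub_nonneg.2 (pow_le_one₀ hp0.le hp1.le)
        · exact fun i _ => sub_le_sub_left
            (pow_le_pow_of_le_one hp0.le hp1.le (Nat.le_sub_of_add_le' (hcard i))) 1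
      _ = p ^ X.card * (1 - p ^ (k - X.card)) ^ m := by simp
end

section
/- Let p ∈ (0,1) and let H be a countably infinite hypergraph with rank r(H) = k. Let X ∉ H be an independent set of vertices such that there is an infinite collection {Y_i}_{i≥1} of pairwise disjoint nonempty sets of vertices, each disjoint from X, with X ∪ Y_i ∈ H for every i ≥ 1. Then r(H ∪ {X}) = k and id_p(H ∪ {X}) = id_p(H). -/
open Filter Topology

open MeasureTheory ProbabilityTheory

/-- The event that every member of `E` meets the zero set of `ω`, i.e. that the random set
`{i | ω i = true}` contains no member of `E`. -/
def indepEvent (E : Set (Finset ℕ)) : Set (ℕ → Bool) :=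
  {ω | ∀ e ∈ E, ∃ i ∈ e, ω i = false}

lemma measurableSet_indepEvent (E : Set (Finset ℕ)) : MeasurableSet (indepEvent E) := by
  have h : indepEvent E = ⋂ e ∈ E, ⋃ i ∈ e, (fun ω : ℕ → Bool => ω i) ⁻¹' {false} := by
    ext ω
    simp [indepEvent]
  rw [h]
  exact MeasurableSet.biInter E.to_countable fun e _ => Finset.measurableSet_biUnion e fun i _ =>
    measurable_pi_apply i (measurableSet_singleton _)

lemma FinHG.indepEvent_edges (C : FinHG) (hC : ∀ e ∈ C.edges, e ⊆ C.verts) :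
    indepEvent (C.edges : Set (Finset ℕ)) =
      ⋃ I ∈ C.verts.powerset.filter fun I => ∀ e ∈ C.edges, ¬ e ⊆ I,
        (C.verts : Set ℕ).pi fun i => {decide (i ∈ I)} := by
  ext ω
  simp only [indepEvent, Finset.mem_coe, Set.mem_ofPred_eq, Finset.mem_filter,
    Finset.mem_powerset, Set.mem_iUnion, Set.mem_pi, Set.mem_singleton_iff, exists_prop]
  constructor
  · intro h
    refine ⟨C.verts.filter fun i => ω i = true, ⟨Finset.filter_subset _ _, ?_⟩, ?_⟩
    · intro e he hsub
      obtain ⟨i, hi, hω⟩ := h e he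
      simpa [hω] using (Finset.mem_filter.1 (hsub hi)).2
    · intro i hi
      cases h : ω i <;> simp [hi, h]
  · rintro ⟨I, ⟨-, hI⟩, hω⟩ e he
    obtain ⟨i, hi, hiI⟩ := Finset.not_subset.1 (hI e he)
    exact ⟨i, hi, by simpa [hiI] using hω i (hC e he hi)⟩

lemma FinHG.idp_eq_measureReal (ν : Measure Bool) [IsProbabilityMeasure ν] {p : ℝ}
    (ht : ν.real {true} = p) (hf : ν.real {false} = 1 - p)
    (C : FinHG) (hC : ∀ e ∈ C.edges, e ⊆ C.verts) :
    C.idp p = (Measure.infinitePi fun _ : ℕ => ν).real (indepEvent C.edges) := by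
  rw [C.indepEvent_edges hC, measureReal_biUnion_finset, FinHG.idp]
  · refine Finset.sum_congr rfl fun I hI => ?_
    have hIV : I ⊆ C.verts := Finset.mem_powerset.1 (Finset.mem_filter.1 hI).1
    rw [measureReal_def, Measure.infinitePi_pi _ fun i _ => measurableSet_singleton _,
      ENNReal.toReal_prod, ← Finset.prod_sdiff hIV, mul_comm]
    congr 1
    · rw [Finset.prod_congr rfl (g := fun _ => 1 - p), Finset.prod_const,
        Finset.card_sdiff_of_subset hIV]
      intro i hi
      simpa [(Finset.mem_sdiff.1 hi).2, measureReal_def] using hf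
    · rw [Finset.prod_congr rfl (g := fun _ => p), Finset.prod_const]
      intro i hi
      simpa [hi, measureReal_def] using ht
  · intro I hI J hJ hIJ
    have hIV := Finset.mem_powerset.1 (Finset.mem_filter.1 hI).1
    have hJV := Finset.mem_powerset.1 (Finset.mem_filter.1 hJ).1
    refine Set.disjoint_left.2 fun ω h₁ h₂ => hIJ ?_
    ext i
    by_cases hi : i ∈ C.verts
    · have h := (h₁ i hi).symm.trans (h₂ i hi)
      simpa using h
    · exact iff_of_false (fun h => hi (hIV h)) fun h => hi (hJV h)
  · exact fun I _ => MeasurableSet.pi C.verts.countable_toSet fun _ _ => measurableSet_singleton _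

lemma HG.idpLim_measureReal (ν : Measure Bool) [IsProbabilityMeasure ν] {p : ℝ}
    (ht : ν.real {true} = p) (hf : ν.real {false} = 1 - p) (H : HG) :
    H.idpLim p ((Measure.infinitePi fun _ : ℕ => ν).real (indepEvent H.edges)) := by
  rintro C ⟨hsub, -, hind, -, hE⟩
  have hmono : Monotone fun n => (C n).edges := monotone_nat_of_le_succ fun n => by
    rw [hind n]
    exact Finset.filter_subset _ _
  have hInter : indepEvent H.edges = ⋂ n, indepEvent ((C n).edges : Set (Finset ℕ)) := by
    ext ω
    simp only [indepEvent, ← hE, Set.mem_iUnion, Set.mem_iInter, Set.mem_ofPred_eq]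
    exact ⟨fun h n e he => h e ⟨n, he⟩, fun h e ⟨n, he⟩ => h n e he⟩
  simp_rw [fun n => FinHG.idp_eq_measureReal ν ht hf (C n) (hsub n), hInter, measureReal_def]
  refine (ENNReal.tendsto_toReal (measure_ne_top _ _)).comp
    (tendsto_measure_iInter_atTop (fun n => (measurableSet_indepEvent _).nullMeasurableSet)
      (fun m n hmn ω h e he => h e (hmono hmn he)) ⟨0, measure_ne_top _ _⟩)

/-- If infinitely many disjoint sets have bounded size, then the random set almost surely
contains one of them. -/
lemma ae_exists_forall_mem_eq_true (ν : Measure Bool) [IsProbabilityMeasure ν]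
    (ht : ν {true} ≠ 0) (Y : ℕ → Finset ℕ) (hY : ∀ i j, i ≠ j → Disjoint (Y i) (Y j))
    (k : ℕ) (hk : ∀ i, (Y i).card ≤ k) :
    ∀ᵐ ω ∂(Measure.infinitePi fun _ : ℕ => ν), ∃ n, ∀ i ∈ Y n, ω i = true := by
  let μ := Measure.infinitePi fun _ : ℕ => ν
  let s : ℕ → Set (ℕ → Bool) := fun n => (Y n : Set ℕ).pi fun _ => {true}
  have hs : ∀ n, MeasurableSet (s n) := fun n =>
    MeasurableSet.pi (Y n).countable_toSet fun _ _ => measurableSet_singleton _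
  have hμ : ∀ W : Finset ℕ, μ ((W : Set ℕ).pi fun _ => {true}) = ν {true} ^ W.card := fun W => by
    rw [Measure.infinitePi_pi _ fun i _ => measurableSet_singleton _, Finset.prod_const]
  have hindep : iIndepSet s μ := by
    rw [iIndepSet_iff_meas_biInter hs]
    intro t
    have h : (⋂ n ∈ t, s n) = ((t.biUnion Y : Finset ℕ) : Set ℕ).pi fun _ => {true} := by
      ext ω
      simp only [s, Set.mem_iInter, Set.mem_pi, Finset.mem_coe, Finset.mem_biUnion]
      exact ⟨fun h i ⟨n, hn, hi⟩ => h n hn i hi, fun h n hn i hi => h i ⟨n, hn, hi⟩⟩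
    rw [h, hμ, Finset.card_biUnion fun i _ j _ hij => hY i j hij,
      Finset.prod_congr rfl fun n _ => hμ (Y n), Finset.prod_pow_eq_pow_sum]
  have hsum : ∑' n, μ (s n) = ⊤ := by
    refine top_le_iff.1 ?_
    rw [← ENNReal.tsum_const_eq_top_of_ne_zero (α := ℕ) (pow_ne_zero k ht)]
    refine ENNReal.tsum_le_tsum fun n => ?_
    rw [hμ (Y n)]
    exact pow_le_pow_of_le_one zero_le prob_le_one (hk n)
  have hlim := (mem_ae_iff_prob_eq_one (MeasurableSet.measurableSet_limsup hs)).2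
    (measure_limsup_eq_one hs hindep hsum)
  filter_upwards [hlim] with ω hω
  rw [mem_limsup_iff_frequently_mem] at hω
  obtain ⟨n, hn⟩ := hω.exists
  exact ⟨n, hn⟩

lemma measureReal_indepEvent_insert (ν : Measure Bool) [IsProbabilityMeasure ν]
    (ht : ν {true} ≠ 0) (E : Set (Finset ℕ)) (X : Finset ℕ) (Y : ℕ → Finset ℕ)
    (hY : ∀ i j, i ≠ j → Disjoint (Y i) (Y j)) (k : ℕ) (hk : ∀ i, (Y i).card ≤ k)
    (hYe : ∀ i, X ∪ Y i ∈ E) :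
    (Measure.infinitePi fun _ : ℕ => ν).real (indepEvent (insert X E)) =
      (Measure.infinitePi fun _ : ℕ => ν).real (indepEvent E) := by
  refine measureReal_congr ?_
  filter_upwards [ae_exists_forall_mem_eq_true ν ht Y hY k hk] with ω ⟨n, hn⟩
  refine propext ⟨fun h e he => h e (Set.mem_insert_of_mem _ he), fun h e he => ?_⟩
  obtain rfl | he := Set.mem_insert_iff.1 he
  · obtain ⟨i, hi, hω⟩ := h _ (hYe n)
    obtain hi | hi := Finset.mem_union.1 hi
    · exact ⟨i, hi, hω⟩
    · simp [hn i hi] at hω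
  · exact h e he

lemma exists_isProbabilityMeasure_bool {p : ℝ} (hp0 : 0 ≤ p) (hp1 : p ≤ 1) :
    ∃ ν : Measure Bool, IsProbabilityMeasure ν ∧ ν.real {true} = p ∧ ν.real {false} = 1 - p := by
  have hp1' : 0 ≤ 1 - p := sub_nonneg.2 hp1
  refine ⟨ENNReal.ofReal p • Measure.dirac true + ENNReal.ofReal (1 - p) • Measure.dirac false,
    ⟨?_⟩, ?_, ?_⟩
  · simp [← ENNReal.ofReal_add hp0 hp1']
  · simp [measureReal_def, hp0]
  · simp [measureReal_def, hp1']

/-- For a countably infinite hypergraph of rank `k`, adding an independent set `X ∉ H`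
as a hyperedge, where `X ∪ Y_i ∈ H` for infinitely many pairwise disjoint nonempty
sets `Y_i` disjoint from `X`, changes neither the rank nor the independence
`p`-density. -/
theorem stmt_11 (p : ℝ) (hp0 : 0 < p) (hp1 : p < 1) (k : ℕ)
    (H : HG) (hHval : H.Valid) (hHinf : H.verts.Infinite) (hrank : H.RankEq k)
    (X : Finset ℕ) (hXne : X.Nonempty) (hXsub : ↑X ⊆ H.verts)
    (hXnot : X ∉ H.edges) (hXind : ∀ e ∈ H.edges, ¬ e ⊆ X)
    (Y : ℕ → Finset ℕ)
    (hYne : ∀ i, (Y i).Nonempty)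
    (hYdisj : ∀ i j, i ≠ j → Disjoint (Y i) (Y j))
    (hYX : ∀ i, Disjoint (Y i) X)
    (hYe : ∀ i, X ∪ Y i ∈ H.edges) :
    (HG.mk H.verts (insert X H.edges)).RankEq k ∧
      ∃ x : ℝ, H.idpLim p x ∧ (HG.mk H.verts (insert X H.edges)).idpLim p x := by
  obtain ⟨ν, hν, ht, hf⟩ := exists_isProbabilityMeasure_bool hp0.le hp1.le
  have ht' : ν {true} ≠ 0 := fun h => hp0.ne (by simpa [measureReal_def, h] using ht)
  have hcard : ∀ i, (Y i).card ≤ k := fun i =>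
    (Finset.card_le_card Finset.subset_union_right).trans (hrank.1 _ (hYe i))
  refine ⟨⟨?_, ?_⟩, _, H.idpLim_measureReal ν ht hf, ?_⟩
  · rintro e (rfl | he)
    · exact (Finset.card_le_card Finset.subset_union_left).trans (hrank.1 _ (hYe 0))
    · exact hrank.1 e he
  · obtain ⟨e, he, hek⟩ := hrank.2
    exact ⟨e, Set.mem_insert_of_mem _ he, hek⟩
  · rw [← measureReal_indepEvent_insert ν ht' H.edges X Y hYdisj k hcard hYe]
    exact HG.idpLim_measureReal ν ht hf _
end
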